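/- If ν ≥ 0, then the Dini function d_ν is strictly log-concave on each component interval of Δ_ν; that is, (d/dx)(d_ν'(x)/d_ν(x)) < 0 for all x ∈ Δ_ν. -/

import Mathlib

open Real Filter Set

/-- The Bessel function of the first kind of order `ν`, defined by its power series. -/
noncomputable def besselJ (ν x : ℝ) : ℝ :=
  ∑' n : ℕ, (-1 : ℝ) ^ n * x ^ (2 * (n : ℝ) + ν) /
    (2 ^ (2 * (n : ℝ) + ν) * (n.factorial : ℝ) * Real.Gamma ((n : ℝ) + ν + 1))

/-- The Dini function `d_ν(x) = (1-ν) J_ν(x) + x J_ν'(x) = J_ν(x) - x J_{ν+1}(x)`. -/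
noncomputable def dini (ν x : ℝ) : ℝ :=
  besselJ ν x - x * besselJ (ν + 1) x

open scoped Topology

/-- The coefficients of the entire function `besselEntire μ`. -/
noncomputable def besselCoeff (μ : ℝ) (n : ℕ) : ℝ :=
  ((n.factorial : ℝ) * Real.Gamma ((n : ℝ) + μ + 1))⁻¹

/-- The entire function `E_μ` for which `J_μ(x) = (x/2)^μ E_μ((x/2)²)`. -/
noncomputable def besselEntire (μ y : ℝ) : ℝ :=
  ∑' n : ℕ, (-1 : ℝ) ^ n * (besselCoeff μ n * y ^ n)

lemma besselCoeff_pos {μ : ℝ} (hμ : 0 ≤ μ) (n : ℕ) : 0 < besselCoeff μ n := by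
  have : 0 < Real.Gamma ((n : ℝ) + μ + 1) := Real.Gamma_pos_of_pos (by positivity)
  unfold besselCoeff
  positivity

lemma besselCoeff_succ {μ : ℝ} (hμ : 0 ≤ μ) (n : ℕ) :
    ((n : ℝ) + 1) * ((n : ℝ) + μ + 1) * besselCoeff μ (n + 1) = besselCoeff μ n := by
  have h1 : (0 : ℝ) < (n : ℝ) + μ + 1 := by positivity
  have h2 : Real.Gamma ((n : ℝ) + μ + 1) ≠ 0 := (Real.Gamma_pos_of_pos h1).ne'
  have h3 : Real.Gamma (((n + 1 : ℕ) : ℝ) + μ + 1)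
      = ((n : ℝ) + μ + 1) * Real.Gamma ((n : ℝ) + μ + 1) := by
    rw [← Real.Gamma_add_one h1.ne']
    push_cast
    ring_nf
  unfold besselCoeff
  rw [h3, Nat.factorial_succ]
  push_cast
  field_simp

lemma succ_mul_besselCoeff_succ (μ : ℝ) (n : ℕ) :
    ((n : ℝ) + 1) * besselCoeff μ (n + 1) = besselCoeff (μ + 1) n := by
  unfold besselCoeff
  rw [show ((n + 1 : ℕ) : ℝ) + μ + 1 = (n : ℝ) + (μ + 1) + 1 by push_cast; ring,
    Nat.factorial_succ]
  push_cast
  field_simp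

lemma besselCoeff_eq_mul {μ : ℝ} (hμ : 0 ≤ μ) (n : ℕ) :
    besselCoeff μ n = ((n : ℝ) + μ + 1) * besselCoeff (μ + 1) n := by
  rw [← succ_mul_besselCoeff_succ, ← besselCoeff_succ hμ]
  ring

lemma besselCoeff_le {μ : ℝ} (hμ : 0 ≤ μ) (n : ℕ) :
    besselCoeff μ n ≤ besselCoeff μ 0 * ((n.factorial : ℝ))⁻¹ := by
  induction n with
  | zero => simp
  | succ n ih =>
    have h := besselCoeff_succ hμ n
    have hp := besselCoeff_pos hμ (n + 1)
    have hle : ((n : ℝ) + 1) * besselCoeff μ (n + 1) ≤ besselCoeff μ n := by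
      rw [← h]
      have : (1 : ℝ) ≤ (n : ℝ) + μ + 1 := by
        have : (0 : ℝ) ≤ n := by positivity
        linarith
      have h0 : 0 ≤ ((n : ℝ) + 1) * besselCoeff μ (n + 1) := by positivity
      nlinarith
    rw [Nat.factorial_succ]
    push_cast
    rw [mul_inv, mul_left_comm, ← div_eq_inv_mul, le_div_iff₀ (by positivity)]
    linarith

lemma abs_besselTerm_le {μ : ℝ} (hμ : 0 ≤ μ) (y : ℝ) (n : ℕ) :
    ‖(-1 : ℝ) ^ n * (besselCoeff μ n * y ^ n)‖ ≤
      besselCoeff μ 0 * (|y| ^ n / (n.factorial : ℝ)) := by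
  rw [norm_mul, norm_pow, norm_neg, norm_one, one_pow, one_mul, norm_mul, norm_pow,
    Real.norm_eq_abs, Real.norm_eq_abs, abs_of_pos (besselCoeff_pos hμ n)]
  calc besselCoeff μ n * |y| ^ n
      ≤ (besselCoeff μ 0 * ((n.factorial : ℝ))⁻¹) * |y| ^ n := by
        gcongr
        exact besselCoeff_le hμ n
    _ = _ := by ring

lemma summable_besselTerm {μ : ℝ} (hμ : 0 ≤ μ) (y : ℝ) :
    Summable fun n : ℕ => (-1 : ℝ) ^ n * (besselCoeff μ n * y ^ n) :=
  Summable.of_norm_bounded ((Real.summable_pow_div_factorial |y|).mul_left _)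
    (abs_besselTerm_le hμ y)

lemma hasDerivAt_besselEntire {μ : ℝ} (hμ : 0 ≤ μ) (y : ℝ) :
    HasDerivAt (besselEntire μ) (-besselEntire (μ + 1) y) y := by
  have hμ1 : 0 ≤ μ + 1 := by linarith
  set R : ℝ := |y| + 1
  have hR : 0 ≤ R := by positivity
  let g' : ℕ → ℝ → ℝ := fun n z => (-1 : ℝ) ^ n * (besselCoeff μ n * ((n : ℝ) * z ^ (n - 1)))
  have hshift : ∀ (n : ℕ) (z : ℝ),
      g' (n + 1) z = -((-1 : ℝ) ^ n * (besselCoeff (μ + 1) n * z ^ n)) := by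
    intro n z
    simp only [g']
    rw [← succ_mul_besselCoeff_succ, Nat.add_sub_cancel, pow_succ]
    push_cast
    ring
  let u : ℕ → ℝ := fun n => |g' n R|
  have hu : Summable u := by
    rw [← summable_nat_add_iff 1]
    have := (summable_besselTerm hμ1 R).norm
    refine this.congr fun n => ?_
    simp only [u, hshift, abs_neg, Real.norm_eq_abs]
  have hD := hasDerivAt_tsum_of_isPreconnected (t := Metric.ball (0 : ℝ) R)
    (g := fun n z => (-1 : ℝ) ^ n * (besselCoeff μ n * z ^ n)) (g' := g') (u := u) (y₀ := y)
    (y := y) hu Metric.isOpen_ball (convex_ball _ _).isPreconnected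
    (fun n z _ => ((hasDerivAt_pow n z).const_mul _).const_mul _)
    (fun n z hz => by
      have hz' : |z| ≤ |R| := by
        rw [abs_of_nonneg hR]
        simpa using (mem_ball_zero_iff.mp hz).le
      simp only [u, g', Real.norm_eq_abs, abs_mul, abs_pow]
      gcongr)
    (by simp [R]) (summable_besselTerm hμ y) (by simp [R])
  have hsum : ∑' n, g' n y = -besselEntire (μ + 1) y := by
    have hs : Summable fun n => g' n y := by
      rw [← summable_nat_add_iff 1]
      exact (summable_besselTerm hμ1 y).neg.congr fun n => (hshift n y).symm
    rw [hs.tsum_eq_zero_add]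
    simp only [hshift, tsum_neg]
    simp [g', besselEntire]
  rw [hsum] at hD
  exact hD

lemma continuous_besselEntire {μ : ℝ} (hμ : 0 ≤ μ) : Continuous (besselEntire μ) :=
  continuous_iff_continuousAt.mpr fun y => (hasDerivAt_besselEntire hμ y).continuousAt

lemma besselEntire_recurrence {μ : ℝ} (hμ : 0 ≤ μ) (y : ℝ) :
    y * besselEntire (μ + 2) y = (μ + 1) * besselEntire (μ + 1) y - besselEntire μ y := by
  have hμ1 : 0 ≤ μ + 1 := by linarith
  have hs0 := summable_besselTerm hμ y
  have hs1 := summable_besselTerm hμ1 y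
  have key : (μ + 1) * besselEntire (μ + 1) y - besselEntire μ y =
      ∑' n : ℕ, ((μ + 1) * ((-1 : ℝ) ^ n * (besselCoeff (μ + 1) n * y ^ n))
        - (-1 : ℝ) ^ n * (besselCoeff μ n * y ^ n)) := by
    rw [(hs1.mul_left (μ + 1)).tsum_sub hs0, tsum_mul_left]
    rfl
  rw [key, ((hs1.mul_left (μ + 1)).sub hs0).tsum_eq_zero_add, besselCoeff_eq_mul hμ 0,
    besselEntire, ← tsum_mul_left]
  simp only [CharP.cast_eq_zero, zero_add, pow_zero, one_mul, mul_one, sub_self]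
  refine tsum_congr fun n => ?_
  rw [besselCoeff_eq_mul hμ (n + 1), show μ + 2 = μ + 1 + 1 by ring,
    ← succ_mul_besselCoeff_succ (μ + 1) n]
  push_cast
  ring

lemma besselEntire_zero (μ : ℝ) : besselEntire μ 0 = besselCoeff μ 0 := by
  rw [besselEntire, tsum_eq_single 0]
  · simp
  · intro n hn
    simp [hn]

lemma antitone_besselTerm {μ y : ℝ} (hμ : 0 ≤ μ) (hy : 0 ≤ y) (hyμ : y ≤ μ + 1) :
    Antitone fun n : ℕ => besselCoeff μ n * y ^ n := by
  refine antitone_nat_of_succ_le fun n => ?_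
  rw [← besselCoeff_succ hμ n, pow_succ]
  have hp := besselCoeff_pos hμ (n + 1)
  have hn : (0 : ℝ) ≤ n := by positivity
  have : y ≤ ((n : ℝ) + 1) * ((n : ℝ) + μ + 1) := by nlinarith
  calc besselCoeff μ (n + 1) * (y ^ n * y) = y * (besselCoeff μ (n + 1) * y ^ n) := by ring
    _ ≤ (((n : ℝ) + 1) * ((n : ℝ) + μ + 1)) * (besselCoeff μ (n + 1) * y ^ n) := by gcongr
    _ = _ := by ring

lemma besselEntire_le {μ y : ℝ} (hμ : 0 ≤ μ) (hy : 0 ≤ y) (hyμ : y ≤ μ + 1) :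
    besselEntire μ y ≤ besselCoeff μ 0 := by
  have h := (antitone_besselTerm hμ hy hyμ).tendsto_le_alternating_series
    (summable_besselTerm hμ y).hasSum.tendsto_sum_nat 0
  simpa [besselEntire] using h

lemma le_besselEntire {μ y : ℝ} (hμ : 0 ≤ μ) (hy : 0 ≤ y) (hyμ : y ≤ μ + 1) :
    besselCoeff μ 0 * (1 - y / (μ + 1)) ≤ besselEntire μ y := by
  have h := (antitone_besselTerm hμ hy hyμ).alternating_series_le_tendsto
    (summable_besselTerm hμ y).hasSum.tendsto_sum_nat 1
  have h1 : besselCoeff μ 0 = (μ + 1) * besselCoeff μ 1 := by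
    have := besselCoeff_succ hμ 0
    simpa using this.symm
  have hμ1 : μ + 1 ≠ 0 := by positivity
  calc besselCoeff μ 0 * (1 - y / (μ + 1)) = besselCoeff μ 0 - besselCoeff μ 1 * y := by
        rw [h1]
        field_simp
    _ ≤ _ := by
        simpa [besselEntire, Finset.sum_range_succ, sub_eq_add_neg] using h

lemma besselEntire_pos {μ y : ℝ} (hμ : 0 ≤ μ) (hy : 0 ≤ y) (hyμ : y < μ + 1) :
    0 < besselEntire μ y := by
  refine lt_of_lt_of_le ?_ (le_besselEntire hμ hy hyμ.le)
  have : y / (μ + 1) < 1 := (div_lt_one (by positivity)).mpr hyμ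
  exact mul_pos (besselCoeff_pos hμ 0) (by linarith)

/-- `J_ν`, written so as to be continuous on the whole line. -/
noncomputable def besselExt (ν x : ℝ) : ℝ := (x / 2) ^ ν * besselEntire ν ((x / 2) ^ 2)

/-- `d_ν`, written so as to be continuous on the whole line. -/
noncomputable def diniExt (ν x : ℝ) : ℝ :=
  (x / 2) ^ ν * (besselEntire ν ((x / 2) ^ 2) - x ^ 2 / 2 * besselEntire (ν + 1) ((x / 2) ^ 2))

lemma besselJ_eq {ν x : ℝ} (hx : 0 < x) : besselJ ν x = besselExt ν x := by
  rw [besselJ, besselExt, besselEntire, ← tsum_mul_left]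
  refine tsum_congr fun n => ?_
  have h2 : (2 : ℝ) ^ (2 * (n : ℝ)) = 2 ^ (2 * n) := by
    rw [← Real.rpow_natCast]
    push_cast
    rfl
  have h3 : x ^ (2 * (n : ℝ)) = x ^ (2 * n) := by
    rw [← Real.rpow_natCast]
    push_cast
    rfl
  rw [besselCoeff, Real.rpow_add hx, Real.rpow_add two_pos, Real.div_rpow hx.le two_pos.le, h2, h3,
    ← pow_mul, div_pow, mul_inv]
  field_simp

lemma dini_eq {ν x : ℝ} (hx : 0 < x) : dini ν x = diniExt ν x := by
  rw [dini, besselJ_eq hx, besselJ_eq hx, besselExt, besselExt, diniExt,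
    Real.rpow_add_one (by positivity : x / 2 ≠ 0)]
  ring

lemma continuous_besselExt {ν : ℝ} (hν : 0 ≤ ν) : Continuous (besselExt ν) := by
  have h := (continuous_besselEntire hν).comp (by fun_prop : Continuous fun x : ℝ => (x / 2) ^ 2)
  exact ((continuous_id.div_const 2).rpow_const fun _ => Or.inr hν).mul h

lemma continuous_diniExt {ν : ℝ} (hν : 0 ≤ ν) : Continuous (diniExt ν) := by
  have hq : Continuous fun x : ℝ => (x / 2) ^ 2 := by fun_prop
  have h := (continuous_besselEntire hν).comp hq
  have h1 := (continuous_besselEntire (by linarith : 0 ≤ ν + 1)).comp hq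
  exact ((continuous_id.div_const 2).rpow_const fun _ => Or.inr hν).mul
    (h.sub ((by fun_prop : Continuous fun x : ℝ => x ^ 2 / 2).mul h1))

lemma hasDerivAt_half_rpow (ν : ℝ) {x : ℝ} (hx : 0 < x) :
    HasDerivAt (fun t : ℝ => (t / 2) ^ ν) (ν * (x / 2) ^ ν / x) x := by
  have h2 : x / 2 ≠ 0 := by positivity
  refine (((hasDerivAt_id' x).div_const 2).rpow_const (p := ν) (Or.inl h2)).congr_deriv ?_
  rw [Real.rpow_sub_one h2]
  field_simp

lemma hasDerivAt_besselEntire_half_sq {μ : ℝ} (hμ : 0 ≤ μ) (x : ℝ) :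
    HasDerivAt (fun t : ℝ => besselEntire μ ((t / 2) ^ 2))
      (-(x / 2) * besselEntire (μ + 1) ((x / 2) ^ 2)) x := by
  have hq : HasDerivAt (fun t : ℝ => (t / 2) ^ 2) (x / 2) x :=
    (((hasDerivAt_id' x).div_const 2).pow 2).congr_deriv (by norm_num; ring)
  exact ((hasDerivAt_besselEntire hμ _).comp x hq).congr_deriv (by ring)

lemma hasDerivAt_besselExt {ν x : ℝ} (hν : 0 ≤ ν) (hx : 0 < x) :
    HasDerivAt (besselExt ν) ((diniExt ν x - (1 - ν) * besselExt ν x) / x) x := by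
  refine ((hasDerivAt_half_rpow ν hx).mul
    (hasDerivAt_besselEntire_half_sq hν x)).congr_deriv ?_
  rw [besselExt, diniExt]
  field_simp
  ring

lemma hasDerivAt_diniExt {ν x : ℝ} (hν : 0 ≤ ν) (hx : 0 < x) :
    HasDerivAt (diniExt ν)
      (((1 - ν) * diniExt ν x + (2 * ν - 1 - x ^ 2) * besselExt ν x) / x) x := by
  have hsq : HasDerivAt (fun t : ℝ => t ^ 2 / 2) x x :=
    ((hasDerivAt_pow 2 x).div_const 2).congr_deriv (by simp)
  refine ((hasDerivAt_half_rpow ν hx).mul ((hasDerivAt_besselEntire_half_sq hν x).sub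
    (hsq.mul (hasDerivAt_besselEntire_half_sq (by linarith : 0 ≤ ν + 1) x)))).congr_deriv ?_
  have hrec := besselEntire_recurrence hν ((x / 2) ^ 2)
  rw [besselExt, diniExt, show ν + 1 + 1 = ν + 2 by ring]
  simp only [Pi.mul_apply, Pi.sub_apply]
  rw [eq_div_iff hx.ne']
  linear_combination (x / 2) ^ ν * x ^ 2 * hrec + (besselEntire ν ((x / 2) ^ 2) -
    x ^ 2 / 2 * besselEntire (ν + 1) ((x / 2) ^ 2)) *
      div_mul_cancel₀ (ν * (x / 2) ^ ν) hx.ne'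

lemma besselExt_pos {ν x : ℝ} (hν : 0 ≤ ν) (hx : 0 < x) (hxν : x ^ 2 < 4 * (ν + 1)) :
    0 < besselExt ν x :=
  mul_pos (Real.rpow_pos_of_pos (by positivity) _)
    (besselEntire_pos hν (by positivity) (by linarith))

lemma diniExt_le_besselExt {ν x : ℝ} (hν : 0 ≤ ν) (hx : 0 < x) (hxν : x ^ 2 < 4 * (ν + 1)) :
    diniExt ν x ≤ besselExt ν x := by
  have h := besselEntire_pos (μ := ν + 1) (y := (x / 2) ^ 2) (by linarith) (by positivity)
    (by linarith)
  refine mul_le_mul_of_nonneg_left ?_ (Real.rpow_nonneg (by positivity) _)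
  have : 0 ≤ x ^ 2 / 2 * besselEntire (ν + 1) ((x / 2) ^ 2) := by positivity
  linarith

lemma mul_besselExt_le_diniExt {ν x : ℝ} (hν : 0 ≤ ν) (hx : 0 < x)
    (hxν : 3 * x ^ 2 ≤ 4 * (ν + 1)) :
    (1 - 3 * x ^ 2 / (4 * (ν + 1))) * besselExt ν x ≤ diniExt ν x := by
  have hν1 : 0 < ν + 1 := by linarith
  have hx2 := sq_nonneg x
  have h1 := besselEntire_le (μ := ν + 1) (y := (x / 2) ^ 2) (by linarith) (by positivity)
    (by linarith)
  have h0 := le_besselEntire (μ := ν) (y := (x / 2) ^ 2) hν (by positivity) (by linarith)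
  have hc : besselCoeff ν 0 = (ν + 1) * besselCoeff (ν + 1) 0 := by
    simpa using besselCoeff_eq_mul hν 0
  have hp := besselCoeff_pos (by linarith : 0 ≤ ν + 1) 0
  have h23 : (2 / 3 : ℝ) ≤ 1 - (x / 2) ^ 2 / (ν + 1) := by
    have : (x / 2) ^ 2 / (ν + 1) ≤ 1 / 3 := by
      rw [div_le_iff₀ hν1]
      linarith
    linarith
  have hE : (ν + 1) * besselEntire (ν + 1) ((x / 2) ^ 2)
      ≤ 3 / 2 * besselEntire ν ((x / 2) ^ 2) := by
    rw [hc] at h0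
    have : (ν + 1) * besselCoeff (ν + 1) 0 * (2 / 3) ≤ besselEntire ν ((x / 2) ^ 2) :=
      le_trans (by gcongr) h0
    nlinarith
  rw [besselExt, diniExt, mul_left_comm]
  refine mul_le_mul_of_nonneg_left ?_ (Real.rpow_nonneg (by positivity) _)
  have key : x ^ 2 / 2 * besselEntire (ν + 1) ((x / 2) ^ 2)
      ≤ 3 * x ^ 2 / (4 * (ν + 1)) * besselEntire ν ((x / 2) ^ 2) := by
    rw [div_mul_eq_mul_div, div_mul_eq_mul_div, div_le_div_iff₀ two_pos (by positivity)]
    have := mul_le_mul_of_nonneg_left hE hx2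
    linarith
  linarith

/-- The numerator `d θ²d - (θd)²` of `θ (θd / d)`, where `θ = x d/dx` and `d = d_ν`. -/
noncomputable def diniLaguerre (ν x : ℝ) : ℝ :=
  (2 * ν - 1 - x ^ 2) * diniExt ν x ^ 2
    - (2 * x ^ 2 + 2 * (1 - ν) * (2 * ν - 1 - x ^ 2)) * (diniExt ν x * besselExt ν x)
    - (2 * ν - 1 - x ^ 2) ^ 2 * besselExt ν x ^ 2

/-- The numerator of `x²` times the second derivative of `log d_ν`. -/
noncomputable def diniWronskian (ν x : ℝ) : ℝ :=
  diniLaguerre ν x - diniExt ν x *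
    ((1 - ν) * diniExt ν x + (2 * ν - 1 - x ^ 2) * besselExt ν x)

lemma continuous_diniLaguerre {ν : ℝ} (hν : 0 ≤ ν) : Continuous (diniLaguerre ν) := by
  have h1 := continuous_besselExt hν
  have h2 := continuous_diniExt hν
  unfold diniLaguerre
  fun_prop

lemma hasDerivAt_diniLaguerre {ν x : ℝ} (hν : 0 ≤ ν) (hx : 0 < x) :
    HasDerivAt (diniLaguerre ν) (-2 * x * (2 * diniExt ν x ^ 2
      + 2 * ν * (diniExt ν x * besselExt ν x)
      - (2 * ν - 1 - x ^ 2) * besselExt ν x ^ 2)) x := by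
  have hJ := hasDerivAt_besselExt hν hx
  have hd := hasDerivAt_diniExt hν hx
  have hX := hasDerivAt_pow 2 x
  have hB := hX.const_sub (2 * ν - 1)
  refine (((hB.mul (hd.pow 2)).sub
    (((hX.const_mul 2).add (hB.const_mul (2 * (1 - ν)))).mul (hd.mul hJ))).sub
      ((hB.pow 2).mul (hJ.pow 2))).congr_deriv ?_
  simp only [Pi.add_apply, Pi.mul_apply, Pi.pow_apply]
  push_cast
  field_simp
  ring

lemma diniLaguerre_zero (ν : ℝ) : diniLaguerre ν 0 = 0 := by
  simp only [diniLaguerre, diniExt, besselExt]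
  ring

lemma besselExt_pos_and_diniExt_nonneg {ν x : ℝ} (hν : 0 ≤ ν) (hx : 0 < x)
    (hxν : 3 * x ^ 2 ≤ 4 * (ν + 1)) : 0 < besselExt ν x ∧ 0 ≤ diniExt ν x := by
  have hJ := besselExt_pos hν hx (by nlinarith)
  refine ⟨hJ, le_trans (mul_nonneg ?_ hJ.le) (mul_besselExt_le_diniExt hν hx hxν)⟩
  rw [sub_nonneg, div_le_one (by positivity)]
  exact hxν

lemma neg_of_hasDerivAt_nonpos {f f' : ℝ → ℝ} (hf : Continuous f) (hf0 : f 0 = 0)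
    (hd : ∀ x, 0 < x → HasDerivAt f (f' x) x) (hle : ∀ x, 0 < x → f' x ≤ 0)
    (hlt : ∀ x, 0 < x → x < 1 → f' x < 0) {x : ℝ} (hx : 0 < x) : f x < 0 := by
  have hanti : StrictAntiOn f (Set.Icc 0 1) := by
    refine strictAntiOn_of_deriv_neg (convex_Icc 0 1) hf.continuousOn fun y hy => ?_
    rw [interior_Icc] at hy
    rw [(hd y hy.1).deriv]
    exact hlt y hy.1 hy.2
  have hanti' : AntitoneOn f (Set.Ici 0) := by
    refine antitoneOn_of_deriv_nonpos (convex_Ici 0) hf.continuousOn (fun y hy => ?_)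
      fun y hy => ?_
    all_goals rw [interior_Ici] at hy
    · exact (hd y hy).differentiableAt.differentiableWithinAt
    · rw [(hd y hy).deriv]
      exact hle y hy
  have hm : 0 < min x 1 := lt_min hx one_pos
  calc f x ≤ f (min x 1) := hanti' (Set.mem_Ici.mpr hm.le) (Set.mem_Ici.mpr hx.le) (min_le_left _ _)
    _ < f 0 := hanti (by simp) ⟨hm.le, min_le_right _ _⟩ hm
    _ = 0 := hf0

lemma diniLaguerre_neg {ν x : ℝ} (hν : 0 ≤ ν) (hν1 : ν < 1) (hx : 0 < x) :
    diniLaguerre ν x < 0 := by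
  have hsmall : ∀ y, 0 < y → 3 * y ^ 2 ≤ 4 * (ν + 1) →
      0 < 2 * diniExt ν y ^ 2 + 2 * ν * (diniExt ν y * besselExt ν y)
        - (2 * ν - 1 - y ^ 2) * besselExt ν y ^ 2 := by
    intro y hy hyν
    obtain ⟨hJ, -⟩ := besselExt_pos_and_diniExt_nonneg hν hy hyν
    have hdJ := mul_besselExt_le_diniExt hν hy hyν
    set τ := 1 - 3 * y ^ 2 / (4 * (ν + 1)) with hτ
    have hy2 : y ^ 2 = 4 / 3 * (ν + 1) * (1 - τ) := by
      rw [hτ]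
      field_simp
      ring
    have hτ1 : τ ≤ 1 := by
      have : 0 ≤ 3 * y ^ 2 / (4 * (ν + 1)) := by positivity
      linarith
    have hτ0 : 0 ≤ τ := by
      rw [hτ, sub_nonneg, div_le_one (by positivity)]
      exact hyν
    generalize besselExt ν y = J at *
    generalize diniExt ν y = d at *
    have hτJ : 0 ≤ τ * J := by positivity
    have h1 : (τ * J) ^ 2 ≤ d ^ 2 := by gcongr
    have h2 : ν * (τ * J * J) ≤ ν * (d * J) := by gcongr
    have h3 : 0 ≤ (4 - 2 * ν) * (1 - τ) * J ^ 2 := by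
      have : 0 ≤ 4 - 2 * ν := by linarith
      have : 0 ≤ 1 - τ := by linarith
      positivity
    have h4 : 0 < J ^ 2 := by positivity
    rw [hy2]
    nlinarith
  refine neg_of_hasDerivAt_nonpos (continuous_diniLaguerre hν) (diniLaguerre_zero ν)
    (fun y hy => hasDerivAt_diniLaguerre hν hy) (fun y hy => ?_) (fun y hy hy1 => ?_) hx
  · refine mul_nonpos_of_nonpos_of_nonneg (by linarith) ?_
    rcases le_or_gt (3 * y ^ 2) (4 * (ν + 1)) with h | h
    · exact (hsmall y hy h).le
    · nlinarith [sq_nonneg (diniExt ν y + ν * besselExt ν y), sq_nonneg (diniExt ν y),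
        sq_nonneg (besselExt ν y), mul_nonneg (by nlinarith : 0 ≤ 1 - ν ^ 2) (sq_nonneg (besselExt ν y)),
        mul_nonneg (by linarith : 0 ≤ y ^ 2 + 1 - 2 * ν - 1) (sq_nonneg (besselExt ν y))]
  · exact mul_neg_of_neg_of_pos (by linarith) (hsmall y hy (by nlinarith))

lemma diniWronskian_eq (ν x : ℝ) : diniWronskian ν x =
    (2 * ν - 1 - x ^ 2 - ν * (1 - ν)) * diniExt ν x ^ 2
      - (2 * ν - 1 + x ^ 2) * (diniExt ν x * besselExt ν x)
      - ((1 - ν) * diniExt ν x + (2 * ν - 1 - x ^ 2) * besselExt ν x) ^ 2 := by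
  rw [diniWronskian, diniLaguerre]
  ring

lemma diniWronskian_neg_of_lt_one {ν x : ℝ} (hν : 0 ≤ ν) (hν1 : ν < 1) (hx : 0 < x) :
    diniWronskian ν x < 0 := by
  have hG := diniLaguerre_neg hν hν1 hx
  have hx2 : 0 < x ^ 2 := by positivity
  have hc : 0 ≤ (1 - ν) * diniExt ν x ^ 2 := mul_nonneg (by linarith) (sq_nonneg _)
  by_cases hs : 0 ≤ (2 * ν - 1 - x ^ 2) * (diniExt ν x * besselExt ν x)
  · rw [diniWronskian]
    linarith
  rw [diniWronskian_eq]
  rcases lt_or_ge 0 (2 * ν - 1 - x ^ 2) with hB | hB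
  · obtain ⟨hJ, hd⟩ := besselExt_pos_and_diniExt_nonneg hν hx (by linarith)
    exact absurd (by positivity) hs
  have hdJ : 0 < diniExt ν x * besselExt ν x := by
    by_contra! h
    exact hs (mul_nonneg_of_nonpos_of_nonpos hB h)
  have hd2 : 0 < diniExt ν x ^ 2 := by
    have : diniExt ν x ≠ 0 := by
      intro h
      simp [h] at hdJ
    positivity
  have hsq := sq_nonneg ((1 - ν) * diniExt ν x + (2 * ν - 1 - x ^ 2) * besselExt ν x)
  have hνν : 0 ≤ ν * (1 - ν) := mul_nonneg hν (by linarith)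
  rcases le_or_gt 0 (2 * ν - 1 + x ^ 2) with hA | hA
  · have : 2 * ν - 1 - x ^ 2 - ν * (1 - ν) < 0 := by
      rcases le_or_gt ν (1 / 2) with h | h <;> nlinarith
    nlinarith [mul_nonneg hA hdJ.le, mul_pos_of_neg_of_neg this (neg_neg_of_pos hd2)]
  · obtain ⟨hJ, hd⟩ := besselExt_pos_and_diniExt_nonneg hν hx (by linarith)
    have hdpos : 0 < diniExt ν x := pos_of_mul_pos_left hdJ hJ.le
    have hτ := mul_besselExt_le_diniExt hν hx (by linarith)
    have hτ' : 1 - 3 / 4 * x ^ 2 ≤ 1 - 3 * x ^ 2 / (4 * (ν + 1)) := by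
      have : 3 * x ^ 2 / (4 * (ν + 1)) ≤ 3 * x ^ 2 / 4 := by
        gcongr
        linarith
      linarith
    have h1 : (1 - 3 / 4 * x ^ 2) * besselExt ν x ≤ diniExt ν x :=
      le_trans (by gcongr) hτ
    have h2 : (1 - 2 * ν - x ^ 2) * besselExt ν x < (x ^ 2 + 1 - 2 * ν) * diniExt ν x := by
      have h3 : 0 ≤ x ^ 2 + 1 - 2 * ν := by linarith
      refine lt_of_lt_of_le ?_ (mul_le_mul_of_nonneg_left h1 h3)
      rw [← mul_assoc]
      refine mul_lt_mul_of_pos_right ?_ hJ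
      nlinarith
    nlinarith [mul_pos hdpos (sub_pos.mpr h2), mul_nonneg hνν hd2.le]

lemma continuous_diniWronskian {ν : ℝ} (hν : 0 ≤ ν) : Continuous (diniWronskian ν) := by
  have h1 := continuous_besselExt hν
  have h2 := continuous_diniExt hν
  have h3 := continuous_diniLaguerre hν
  unfold diniWronskian
  fun_prop

lemma hasDerivAt_diniWronskian {ν x : ℝ} (hν : 0 ≤ ν) (hx : 0 < x) :
    HasDerivAt (diniWronskian ν)
      ((-2 * x ^ 2 * (2 * diniExt ν x ^ 2 + 2 * ν * (diniExt ν x * besselExt ν x)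
          - (2 * ν - 1 - x ^ 2) * besselExt ν x ^ 2)
        - ((1 - ν) * diniExt ν x + (2 * ν - 1 - x ^ 2) * besselExt ν x) ^ 2
        - diniExt ν x * ((1 - ν) * ((1 - ν) * diniExt ν x + (2 * ν - 1 - x ^ 2) * besselExt ν x)
          - 2 * x ^ 2 * besselExt ν x
          + (2 * ν - 1 - x ^ 2) * (diniExt ν x - (1 - ν) * besselExt ν x))) / x) x := by
  have hJ := hasDerivAt_besselExt hν hx
  have hd := hasDerivAt_diniExt hν hx
  have hB := (hasDerivAt_pow 2 x).const_sub (2 * ν - 1)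
  refine ((hasDerivAt_diniLaguerre hν hx).sub
    (hd.mul ((hd.const_mul (1 - ν)).add (hB.mul hJ)))).congr_deriv ?_
  simp only [Pi.add_apply, Pi.mul_apply]
  push_cast
  field_simp
  ring

lemma besselExt_zero {ν : ℝ} (hν : 0 < ν) : besselExt ν 0 = 0 := by
  simp [besselExt, Real.zero_rpow hν.ne']

lemma diniExt_zero {ν : ℝ} (hν : 0 < ν) : diniExt ν 0 = 0 := by
  simp [diniExt, Real.zero_rpow hν.ne']

lemma diniExt_pos {ν x : ℝ} (hν : 1 ≤ ν) (hx : 0 < x) (hxν : x ^ 2 ≤ 2 * ν - 1) :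
    0 < diniExt ν x := by
  have hν0 : 0 ≤ ν := by linarith
  have hmono : StrictMonoOn (fun t : ℝ => t ^ (ν - 1) * diniExt ν t) (Set.Icc 0 x) := by
    refine strictMonoOn_of_deriv_pos (convex_Icc 0 x) (Continuous.continuousOn ?_) fun y hy => ?_
    · exact (continuous_id.rpow_const fun _ => Or.inr (by linarith)).mul (continuous_diniExt hν0)
    · rw [interior_Icc] at hy
      have hy0 : 0 < y := hy.1
      have hyx : y ^ 2 < x ^ 2 := by
        have := hy.2
        gcongr
      have hd := (Real.hasDerivAt_rpow_const (p := ν - 1) (Or.inl hy0.ne')).mul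
        (hasDerivAt_diniExt hν0 hy0)
      have hJ := besselExt_pos hν0 hy0 (by linarith)
      have hB : 0 < 2 * ν - 1 - y ^ 2 := by linarith
      have hp : 0 < y ^ (ν - 1) := Real.rpow_pos_of_pos hy0 _
      have heq : deriv (fun t : ℝ => t ^ (ν - 1) * diniExt ν t) y
          = y ^ (ν - 1) * ((2 * ν - 1 - y ^ 2) * besselExt ν y) / y := by
        refine (hd.congr_deriv ?_).deriv
        rw [Real.rpow_sub_one hy0.ne' (ν - 1)]
        field_simp
        ring
      rw [heq]
      positivity
  have h := hmono (Set.left_mem_Icc.mpr hx.le) (Set.right_mem_Icc.mpr hx.le) hx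
  simp only [diniExt_zero (by linarith : 0 < ν), mul_zero] at h
  exact pos_of_mul_pos_right h (Real.rpow_nonneg hx.le _)

lemma sq_add_sq_pos_of_bessel {ν x : ℝ} (hν : 0 < ν) (hx : 0 < x) :
    0 < (diniExt ν x - (1 - ν) * besselExt ν x) ^ 2 + (x ^ 2 - ν ^ 2) * besselExt ν x ^ 2 := by
  let f : ℝ → ℝ := fun t => (ν ^ 2 - t ^ 2) * besselExt ν t ^ 2
    - (diniExt ν t - (1 - ν) * besselExt ν t) ^ 2
  have h1 := continuous_besselExt hν.le
  have h2 := continuous_diniExt hν.le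
  have h : f x < 0 := by
    refine neg_of_hasDerivAt_nonpos (f' := fun t => -2 * t * besselExt ν t ^ 2)
      (by fun_prop) ?_ (fun t ht => ?_) (fun t ht => ?_) (fun t ht ht1 => ?_) hx
    · simp [f, besselExt_zero hν, diniExt_zero hν]
    · have hJ := hasDerivAt_besselExt hν.le ht
      have hd := hasDerivAt_diniExt hν.le ht
      have hB := (hasDerivAt_pow 2 t).const_sub (ν ^ 2)
      refine ((hB.mul (hJ.pow 2)).sub ((hd.sub (hJ.const_mul (1 - ν))).pow 2)).congr_deriv ?_
      simp only [Pi.sub_apply, Pi.pow_apply]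
      push_cast
      field_simp
      ring
    · nlinarith [mul_nonneg ht.le (sq_nonneg (besselExt ν t))]
    · have hJ := besselExt_pos hν.le ht (by nlinarith)
      have : 0 < t * besselExt ν t ^ 2 := by positivity
      linarith
  simp only [f] at h
  linarith

lemma diniWronskian_neg_near_zero {ν : ℝ} (hν : 0 < ν) :
    ∀ᶠ x in 𝓝[>] (0 : ℝ), diniWronskian ν x < 0 := by
  let E : ℝ → ℝ := fun x => besselEntire ν ((x / 2) ^ 2)
  let D : ℝ → ℝ := fun x =>
    besselEntire ν ((x / 2) ^ 2) - x ^ 2 / 2 * besselEntire (ν + 1) ((x / 2) ^ 2)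
  let φ : ℝ → ℝ := fun x => (2 * ν - 1 - x ^ 2 - ν * (1 - ν)) * D x ^ 2
      - (2 * ν - 1 + x ^ 2) * (D x * E x) - ((1 - ν) * D x + (2 * ν - 1 - x ^ 2) * E x) ^ 2
  have hE : Continuous E :=
    (continuous_besselEntire hν.le).comp (by fun_prop : Continuous fun x : ℝ => (x / 2) ^ 2)
  have hE1 : Continuous fun x : ℝ => besselEntire (ν + 1) ((x / 2) ^ 2) :=
    (continuous_besselEntire (by linarith)).comp (by fun_prop)
  have hD : Continuous D := hE.sub ((by fun_prop : Continuous fun x : ℝ => x ^ 2 / 2).mul hE1)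
  have hφ : Continuous φ := by fun_prop
  have hφ0 : φ 0 < 0 := by
    have hp := besselCoeff_pos hν.le 0
    have : φ 0 = -(ν * besselCoeff ν 0 ^ 2) := by
      simp only [φ, D, E]
      norm_num [besselEntire_zero]
      ring
    rw [this]
    have : 0 < ν * besselCoeff ν 0 ^ 2 := by positivity
    linarith
  have hev : ∀ᶠ x in 𝓝[>] (0 : ℝ), φ x < 0 :=
    (hφ.continuousAt.eventually_lt continuousAt_const hφ0).filter_mono nhdsWithin_le_nhds
  filter_upwards [hev, self_mem_nhdsWithin] with x hx hx0
  have hx0' : (0 : ℝ) < x := hx0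
  have hp : 0 < (x / 2) ^ ν := Real.rpow_pos_of_pos (by positivity) _
  have heq : diniWronskian ν x = ((x / 2) ^ ν) ^ 2 * φ x := by
    rw [diniWronskian_eq, diniExt, besselExt]
    simp only [φ, D, E]
    ring
  rw [heq]
  exact mul_neg_of_pos_of_neg (by positivity) hx

lemma deriv_diniWronskian_neg {ν x : ℝ} (hν : 1 ≤ ν) (hx : 0 < x) (hW : diniWronskian ν x = 0) :
    -2 * x ^ 2 * (2 * diniExt ν x ^ 2 + 2 * ν * (diniExt ν x * besselExt ν x)
          - (2 * ν - 1 - x ^ 2) * besselExt ν x ^ 2)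
        - ((1 - ν) * diniExt ν x + (2 * ν - 1 - x ^ 2) * besselExt ν x) ^ 2
        - diniExt ν x * ((1 - ν) * ((1 - ν) * diniExt ν x + (2 * ν - 1 - x ^ 2) * besselExt ν x)
          - 2 * x ^ 2 * besselExt ν x
          + (2 * ν - 1 - x ^ 2) * (diniExt ν x - (1 - ν) * besselExt ν x)) < 0 := by
  have hν0 : 0 ≤ ν := by linarith
  have hx2 : 0 < x ^ 2 := by positivity
  have hJpos := besselExt_pos hν0 hx
  have hle := diniExt_le_besselExt hν0 hx
  have hdpos := diniExt_pos hν hx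
  have hN := sq_add_sq_pos_of_bessel (by linarith : 0 < ν) hx
  rw [diniWronskian, diniLaguerre] at hW
  generalize besselExt ν x = J at *
  generalize diniExt ν x = d at *
  generalize hX : x ^ 2 = X at *
  clear hX
  set T := -2 * X * (2 * d ^ 2 + 2 * ν * (d * J) - (2 * ν - 1 - X) * J ^ 2)
        - ((1 - ν) * d + (2 * ν - 1 - X) * J) ^ 2
        - d * ((1 - ν) * ((1 - ν) * d + (2 * ν - 1 - X) * J)
          - 2 * X * J + (2 * ν - 1 - X) * (d - (1 - ν) * J)) with hT
  obtain ⟨B, hB⟩ : ∃ B, B = 2 * ν - 1 - X := ⟨_, rfl⟩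
  have hXB : X = 2 * ν - 1 - B := by linarith
  have hT1 : B * T = -(B * (((1 - ν) * d + B * J) * (2 * ((1 - ν) * d + B * J) + d))
      + 2 * X * ((1 - ν + B) * d ^ 2 + (B + 2 * (2 * ν - 1)) * (d * J))) := by
    rw [hT, hB]
    linear_combination (-(2 * X + (2 * ν - 1 - X))) * hW
  have hT2 : B * T = B * (((1 - ν) * d + B * J) * d - (2 * B + 2 * (1 - ν) ^ 2) * d ^ 2)
      + 2 * X * ((B - 2 * (2 * ν - 1)) * (d * J) - (1 - ν + B) * d ^ 2) := by
    rw [hT, hB]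
    linear_combination ((2 * ν - 1 - X) - 2 * X) * hW
  clear_value T
  rcases lt_or_ge 0 B with hB0 | hB0
  · -- before `x² = 2ν - 1` both `d` and `J` are positive
    have hJ := hJpos (by linarith)
    have hd := hdpos (by linarith)
    have hdJ := hle (by linarith)
    have hdd : d ^ 2 ≤ d * J := by
      rw [sq]
      exact mul_le_mul_of_nonneg_left hdJ hd.le
    have hdJ0 : 0 < d * J := by positivity
    have hνd : (ν - 1) * d ^ 2 ≤ (ν - 1) * (d * J) :=
      mul_le_mul_of_nonneg_left hdd (by linarith)
    have hd2 : 0 < d ^ 2 := by positivity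
    suffices B * T < 0 by
      by_contra! h
      exact absurd (mul_nonneg hB0.le h) (not_le.mpr this)
    rcases le_or_gt 0 ((1 - ν) * d + B * J) with he | he
    · rw [hT1]
      have h1 : 0 ≤ B * (((1 - ν) * d + B * J) * (2 * ((1 - ν) * d + B * J) + d)) := by positivity
      have h2 : 0 < (1 - ν + B) * d ^ 2 + (B + 2 * (2 * ν - 1)) * (d * J) := by
        have : 0 < (B + 3 * ν - 1) * (d * J) := mul_pos (by linarith) hdJ0
        have : 0 < B * d ^ 2 := by positivity
        linarith
      have h3 := mul_pos hx2 h2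
      linarith
    · rw [hT2]
      have h1 : ((1 - ν) * d + B * J) * d < 0 := mul_neg_of_neg_of_pos he hd
      have h2 : 0 ≤ (2 * B + 2 * (1 - ν) ^ 2) * d ^ 2 := by positivity
      have h3 := mul_pos hB0 (by linarith :
        0 < (2 * B + 2 * (1 - ν) ^ 2) * d ^ 2 - ((1 - ν) * d + B * J) * d)
      have h4 : (B - 2 * (2 * ν - 1)) * (d * J) - (1 - ν + B) * d ^ 2 ≤ 0 := by
        have : 0 ≤ (2 * (2 * ν - 1) - B - (ν - 1)) * (d * J) := mul_nonneg (by linarith) hdJ0.le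
        have : 0 < B * d ^ 2 := by positivity
        linarith
      have h5 := mul_nonneg hx2.le (neg_nonneg.mpr h4)
      linarith
  obtain ⟨b, hb⟩ : ∃ b, b = -B := ⟨_, rfl⟩
  have hb0 : 0 ≤ b := by linarith
  obtain rfl : B = -b := by linarith
  rcases le_or_gt 0 (d * J) with hdJ | hdJ
  · -- here the Wronskian cannot vanish
    exfalso
    have hW' : (ν - 1 - b) * d ^ 2 - (2 * ν - 1) * (b + 2) * (d * J) - b ^ 2 * J ^ 2 = 0 := by
      rw [hXB] at hW
      linear_combination hW
    have h1 : 0 ≤ (2 * ν - 1) * b * (d * J) :=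
      mul_nonneg (mul_nonneg (by linarith) hb0) hdJ
    rcases lt_or_ge X (4 * (ν + 1)) with hXν | hXν
    · have hJ := hJpos hXν
      have hd : 0 ≤ d := nonneg_of_mul_nonneg_left hdJ hJ
      have hdd : d ^ 2 ≤ d * J := by
        rw [sq]
        exact mul_le_mul_of_nonneg_left (hle hXν) hd
      rcases hd.eq_or_lt with rfl | hd
      · have hbpos : 0 < b := by
          by_contra! h
          exact lt_irrefl _ (hdpos (by linarith))
        have : 0 < b ^ 2 * J ^ 2 := by positivity
        linarith
      · have h2 : 0 < d * J := by positivity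
        have h3 : 0 ≤ b * d ^ 2 := by positivity
        have h4 : 0 ≤ b ^ 2 * J ^ 2 := by positivity
        have h5 : (ν - 1) * d ^ 2 ≤ (ν - 1) * (d * J) :=
          mul_le_mul_of_nonneg_left hdd (by linarith)
        have h6 : 0 ≤ (ν - 1) * (d * J) := mul_nonneg (by linarith) h2.le
        linarith
    · have hb1 : 1 ≤ b := by linarith
      have h2 : 0 ≤ (2 * ν - 1) * (d * J) := mul_nonneg (by linarith) hdJ
      have h3 : 1 ≤ b - (ν - 1) := by linarith
      have h4 : d ^ 2 ≤ (b - (ν - 1)) * d ^ 2 := le_mul_of_one_le_left (sq_nonneg d) h3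
      have h5 : J ^ 2 ≤ b ^ 2 * J ^ 2 := le_mul_of_one_le_left (sq_nonneg J) (one_le_pow₀ hb1)
      have h6 : d ^ 2 + J ^ 2 ≤ 0 := by linarith
      have hd0 : d = 0 := pow_eq_zero_iff two_ne_zero |>.mp (by linarith [sq_nonneg d, sq_nonneg J])
      have hJ0 : J = 0 := pow_eq_zero_iff two_ne_zero |>.mp (by linarith [sq_nonneg d, sq_nonneg J])
      simp [hd0, hJ0] at hN
  · have hbpos : 0 < b := by
      by_contra! h
      have hJ := hJpos (by linarith)
      have hd := hdpos (by linarith)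
      exact absurd hdJ (not_lt.mpr (by positivity))
    suffices 0 < -b * T from by
      by_contra! h
      exact absurd (mul_nonneg hbpos.le h) (not_le.mpr (by linarith))
    have hd2 : 0 < d ^ 2 := by
      have : d ≠ 0 := by
        rintro rfl
        simp at hdJ
      positivity
    have hA : 0 < 2 * ν - 1 := by linarith
    have hX' : X = 2 * ν - 1 + b := by linarith
    rw [hT2, hX']
    have h1 : 0 < (b ^ 2 + 6 * (2 * ν - 1) * b + 4 * (2 * ν - 1) ^ 2) * (-(d * J)) :=
      mul_pos (by positivity) (by linarith)
    have h2 : 0 ≤ ((ν - 1) * (3 * b + 2 * (2 * ν - 1)) + 2 * b * (ν - 1) ^ 2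
        + 2 * (2 * ν - 1) * b) * d ^ 2 := by
      have : 0 ≤ ν - 1 := by linarith
      positivity
    linarith

lemma diniWronskian_neg_of_one_le {ν x : ℝ} (hν : 1 ≤ ν) (hx : 0 < x) :
    diniWronskian ν x < 0 := by
  have hν0 : 0 ≤ ν := by linarith
  have hle : ∀ y, 0 < y → diniWronskian ν y ≤ 0 := by
    intro y hy
    obtain ⟨ε, hε, hε0, hεy⟩ := ((diniWronskian_neg_near_zero (by linarith : 0 < ν)).and
      (Ioo_mem_nhdsGT hy)).exists
    exact image_le_of_deriv_right_lt_deriv_boundary (B := fun _ => 0) (B' := fun _ => 0)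
      (continuous_diniWronskian hν0).continuousOn
      (fun z hz => (hasDerivAt_diniWronskian hν0 (hε0.trans_le hz.1)).hasDerivWithinAt)
      hε.le (fun z => hasDerivAt_const z 0)
      (fun z hz h => div_neg_of_neg_of_pos (deriv_diniWronskian_neg hν (hε0.trans_le hz.1) h)
        (hε0.trans_le hz.1)) (Set.right_mem_Icc.mpr hεy.le)
  refine lt_of_le_of_ne (hle x hx) fun h => ?_
  have hmax : IsLocalMax (diniWronskian ν) x := by
    filter_upwards [lt_mem_nhds hx] with y hy
    rw [h]
    exact hle y hy
  have h0 := hmax.hasDerivAt_eq_zero (hasDerivAt_diniWronskian hν0 hx)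
  exact (div_neg_of_neg_of_pos (deriv_diniWronskian_neg hν hx h) hx).ne h0

lemma diniWronskian_neg {ν x : ℝ} (hν : 0 ≤ ν) (hx : 0 < x) : diniWronskian ν x < 0 :=
  (lt_or_ge ν 1).elim (fun h => diniWronskian_neg_of_lt_one hν h hx)
    fun h => diniWronskian_neg_of_one_le h hx

lemma hasDerivAt_dini {ν x : ℝ} (hν : 0 ≤ ν) (hx : 0 < x) :
    HasDerivAt (dini ν) (((1 - ν) * diniExt ν x + (2 * ν - 1 - x ^ 2) * besselExt ν x) / x) x :=
  (hasDerivAt_diniExt hν hx).congr_of_eventuallyEq <| by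
    filter_upwards [lt_mem_nhds hx] with y hy using dini_eq hy

lemma deriv_logDeriv_dini_neg {ν x : ℝ} (hν : 0 ≤ ν) (hx : 0 < x) (hne : dini ν x ≠ 0) :
    deriv (fun t : ℝ => deriv (dini ν) t / dini ν t) x < 0 := by
  rw [dini_eq hx] at hne
  have heq : (fun t : ℝ => deriv (dini ν) t / dini ν t) =ᶠ[𝓝 x] fun t =>
      ((1 - ν) * diniExt ν t + (2 * ν - 1 - t ^ 2) * besselExt ν t) / (t * diniExt ν t) := by
    filter_upwards [lt_mem_nhds hx] with y hy
    rw [(hasDerivAt_dini hν hy).deriv, dini_eq hy, div_div]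
  have hJ := hasDerivAt_besselExt hν hx
  have hd := hasDerivAt_diniExt hν hx
  have hB := (hasDerivAt_pow 2 x).const_sub (2 * ν - 1)
  have h : HasDerivAt (fun t => ((1 - ν) * diniExt ν t + (2 * ν - 1 - t ^ 2) * besselExt ν t)
      / (t * diniExt ν t)) (diniWronskian ν x / (x * diniExt ν x) ^ 2) x := by
    refine (((hd.const_mul (1 - ν)).add (hB.mul hJ)).div ((hasDerivAt_id' x).mul hd)
      (mul_ne_zero hx.ne' hne)).congr_deriv ?_
    simp only [Pi.add_apply, Pi.mul_apply]
    rw [diniWronskian, diniLaguerre]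
    push_cast
    field_simp
    ring
  rw [heq.deriv_eq, h.deriv]
  exact div_neg_of_neg_of_pos (diniWronskian_neg hν hx) (by positivity)

/-- If `ν ≥ 0`, with `α 1 < α 2 < ⋯` the positive zeros of `d_ν`,
`α 0 = 0`, and `Δ_ν = ⋃_{k ≥ 0} (α (2k), α (2k+1))`, then the Dini function `d_ν` is
strictly log-concave on each component interval of `Δ_ν`; that is,
`(d/dx)(d_ν'(x)/d_ν(x)) < 0` for all `x ∈ Δ_ν`. -/
theorem dini_strictly_log_concave (ν : ℝ) (hν : 0 ≤ ν) (α : ℕ → ℝ)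
    (hα0 : α 0 = 0) (hmono : StrictMono α)
    (hzeros : ∀ x : ℝ, (0 < x ∧ dini ν x = 0) ↔ ∃ n, 1 ≤ n ∧ α n = x) :
    (∀ k : ℕ, StrictConcaveOn ℝ (Set.Ioo (α (2 * k)) (α (2 * k + 1)))
      (fun x : ℝ => Real.log (dini ν x))) ∧
    (∀ x ∈ ⋃ k : ℕ, Set.Ioo (α (2 * k)) (α (2 * k + 1)),
      deriv (fun t : ℝ => deriv (dini ν) t / dini ν t) x < 0) := by
  have hmem : ∀ k : ℕ, ∀ x ∈ Set.Ioo (α (2 * k)) (α (2 * k + 1)), 0 < x ∧ dini ν x ≠ 0 := by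
    intro k x hx
    have hx0 : 0 < x := lt_of_le_of_lt (hα0 ▸ hmono.monotone (Nat.zero_le _)) hx.1
    refine ⟨hx0, fun h => ?_⟩
    obtain ⟨n, -, rfl⟩ := (hzeros x).mp ⟨hx0, h⟩
    have h1 := hmono.lt_iff_lt.mp hx.1
    have h2 := hmono.lt_iff_lt.mp hx.2
    omega
  refine ⟨fun k => ?_, fun x hx => ?_⟩
  · have hlog : ∀ x ∈ Set.Ioo (α (2 * k)) (α (2 * k + 1)),
        HasDerivAt (fun t => Real.log (dini ν t)) (deriv (dini ν) x / dini ν x) x := by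
      intro x hx
      obtain ⟨hx0, hne⟩ := hmem k x hx
      exact (hasDerivAt_dini hν hx0).differentiableAt.hasDerivAt.log hne
    refine strictConcaveOn_of_deriv2_neg' (convex_Ioo _ _)
      (fun x hx => (hlog x hx).continuousAt.continuousWithinAt) fun x hx => ?_
    obtain ⟨hx0, hne⟩ := hmem k x hx
    have heq : deriv (fun t => Real.log (dini ν t)) =ᶠ[𝓝 x]
        fun t => deriv (dini ν) t / dini ν t := by
      filter_upwards [Ioo_mem_nhds hx.1 hx.2] with y hy using (hlog y hy).deriv
    simp only [Function.iterate_succ, Function.iterate_zero, Function.comp_apply, id_eq]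
    rw [heq.deriv_eq]
    exact deriv_logDeriv_dini_neg hν hx0 hne
  · obtain ⟨k, hk⟩ := Set.mem_iUnion.mp hx
    obtain ⟨hx0, hne⟩ := hmem k x hk
    exact deriv_logDeriv_dini_neg hν hx0 hne
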